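/- arXiv:1605.07804 — 4 statements merged into one kernel-verified Lean document; each statement's English description precedes it below -/
import Mathlib

section
/- Let 0 < α < 1 and b_j := (j+1)^{1-α} − j^{1-α} for integers j ≥ 0. Then for every integer k ≥ 1, (1 − b_1)·(1/(k+1)) + ∑_{j=1}^{k-1} (b_j − b_{j+1})·((j+1)/(k+1)) + b_k ≥ 1/(k+1). -/
/-- The L1 coefficients `b_j = (j+1)^(1-α) - j^(1-α)`. -/
noncomputable def bcoef (α : ℝ) (j : ℕ) : ℝ :=
  ((j : ℝ) + 1) ^ (1 - α) - (j : ℝ) ^ (1 - α)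

/-- Summation by parts for the L1 coefficients: the weighted sum telescopes. -/
theorem bcoef_weighted_sum_eq (α : ℝ) {k : ℕ} (hk : 1 ≤ k) :
    (1 - bcoef α 1)
      + (∑ j ∈ Finset.Ico 1 k, (bcoef α j - bcoef α (j + 1)) * ((j : ℝ) + 1))
      + ((k : ℝ) + 1) * bcoef α k = ((k : ℝ) + 1) ^ (1 - α) := by
  induction k, hk using Nat.le_induction with
  | base => simp [bcoef]; ring
  | succ k hk ih =>
    have h : bcoef α (k + 1) = ((k : ℝ) + 1 + 1) ^ (1 - α) - ((k : ℝ) + 1) ^ (1 - α) := by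
      simp [bcoef]
    rw [Finset.sum_Ico_succ_top hk]
    push_cast
    linear_combination ih + h

theorem bcoef_weighted_sum_ge (α : ℝ) (hα0 : 0 < α) (hα1 : α < 1)
    (k : ℕ) (hk : 1 ≤ k) :
    (1 - bcoef α 1) * (1 / ((k : ℝ) + 1))
      + (∑ j ∈ Finset.Ico 1 k,
          (bcoef α j - bcoef α (j + 1)) * (((j : ℝ) + 1) / ((k : ℝ) + 1)))
      + bcoef α k ≥ 1 / ((k : ℝ) + 1) := by
  have hpos : (0 : ℝ) < (k : ℝ) + 1 := by positivity
  have hone : (1 : ℝ) ≤ ((k : ℝ) + 1) ^ (1 - α) :=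
    Real.one_le_rpow (by linarith [k.cast_nonneg (α := ℝ)]) (by linarith)
  rw [← bcoef_weighted_sum_eq α hk] at hone
  simp only [← mul_div_assoc, ← Finset.sum_div]
  rw [ge_iff_le, div_le_iff₀ hpos]
  refine hone.trans_eq ?_
  field_simp
end

section
/- Let 0 < α < 1, T > 0, K a positive integer, δ := T/K, t_j := j·δ, and b_j := (j+1)^{1-α} − j^{1-α}. Let u : [0, T] → ℝ be twice continuously differentiable. Then there exists a constant C ≥ 0, depending only on α and sup_{t ∈ [0,T]} |u''(t)|, such that for every integer 0 ≤ k ≤ K−1, |(1/Γ(1−α)) ∫_0^{t_{k+1}} (t_{k+1} − s)^{−α} u'(s) ds − (1/Γ(2−α)) δ^{−α} ∑_{j=0}^{k} b_j (u(t_{k+1-j}) − u(t_{k-j}))| ≤ C · δ^{2−α}. -/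
open MeasureTheory

/-- If `g` has mean zero, the integral of `g` against a monotone weight is controlled by the
increment of the weight. -/
theorem abs_integral_mul_le_of_integral_eq_zero {a b L : ℝ} (hab : a ≤ b) {w g : ℝ → ℝ}
    (hw : MonotoneOn w (Set.Icc a b)) (hg : Continuous g) (hg0 : ∫ s in a..b, g s = 0)
    (hgL : ∀ s ∈ Set.Icc a b, |g s| ≤ L) :
    |∫ s in a..b, w s * g s| ≤ L * (b - a) * (w b - w a) := by
  have hwi : IntervalIntegrable w volume a b := by
    apply MonotoneOn.intervalIntegrable
    rwa [Set.uIcc_of_le hab]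
  have hsub : ∫ s in a..b, w s * g s = ∫ s in a..b, (w s - w a) * g s := by
    simp only [sub_mul]
    rw [intervalIntegral.integral_sub (hwi.mul_continuousOn hg.continuousOn)
      ((hg.intervalIntegrable a b).const_mul _), intervalIntegral.integral_const_mul, hg0]
    ring
  have hbound : ∀ s ∈ Set.uIoc a b, ‖(w s - w a) * g s‖ ≤ (w b - w a) * L := by
    intro s hs
    rw [Set.uIoc_of_le hab] at hs
    have hs' : s ∈ Set.Icc a b := ⟨hs.1.le, hs.2⟩
    have h1 : w a ≤ w s := hw (Set.left_mem_Icc.2 hab) hs' hs.1.le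
    have h2 : w s ≤ w b := hw hs' (Set.right_mem_Icc.2 hab) hs.2
    rw [Real.norm_eq_abs, abs_mul, abs_of_nonneg (sub_nonneg.2 h1)]
    exact mul_le_mul (by linarith) (hgL s hs') (abs_nonneg _) (by linarith)
  have h := intervalIntegral.norm_integral_le_of_norm_le_const hbound
  rw [Real.norm_eq_abs, abs_of_nonneg (sub_nonneg.2 hab)] at h
  rw [hsub]
  linarith

/-- On an interval where `|u''| ≤ M`, the derivative of `u` differs from the slope of the chord
by at most `M` times the length. -/
theorem abs_deriv_sub_slope_le {a b M : ℝ} (hab : a < b) {u : ℝ → ℝ} (hu : ContDiff ℝ 2 u)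
    (hM : ∀ t ∈ Set.Icc a b, |deriv (deriv u) t| ≤ M) :
    ∀ s ∈ Set.Icc a b, |deriv u s - (u b - u a) / (b - a)| ≤ M * (b - a) := by
  intro s hs
  have hM0 : 0 ≤ M := (abs_nonneg _).trans (hM s hs)
  have hd : Differentiable ℝ u := hu.differentiable (by norm_num)
  have hd' : Differentiable ℝ (deriv u) :=
    ((contDiff_succ_iff_deriv (n := 1)).1 hu).2.2.differentiable (by norm_num)
  obtain ⟨ξ, hξ, hξ'⟩ := exists_deriv_eq_slope u hab hd.continuous.continuousOn
    hd.differentiableOn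
  have h := (convex_Icc a b).norm_image_sub_le_of_norm_deriv_le (f := deriv u) (C := M)
    (fun x _ => hd' x) hM (Set.Ioo_subset_Icc_self hξ) hs
  rw [← hξ']
  refine h.trans (mul_le_mul_of_nonneg_left ?_ hM0)
  rw [Real.norm_eq_abs, abs_le]
  constructor <;> linarith [hs.1, hs.2, hξ.1, hξ.2]

theorem integral_deriv_sub_slope {a b : ℝ} (hab : a < b) {u : ℝ → ℝ} (hu : ContDiff ℝ 2 u) :
    ∫ s in a..b, (deriv u s - (u b - u a) / (b - a)) = 0 := by
  have hc : Continuous (deriv u) := hu.continuous_deriv (by norm_num)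
  rw [intervalIntegral.integral_sub (hc.intervalIntegrable _ _) (by simp),
    intervalIntegral.integral_deriv_eq_sub
      (fun x _ => hu.differentiable (by norm_num) x) (hc.intervalIntegrable _ _),
    intervalIntegral.integral_const, smul_eq_mul, mul_div_cancel₀ _ (sub_pos.2 hab).ne', sub_self]

theorem intervalIntegrable_sub_rpow_neg {α : ℝ} (hα1 : α < 1) (t a b : ℝ) :
    IntervalIntegrable (fun s => (t - s) ^ (-α)) volume a b := by
  have h := (intervalIntegral.intervalIntegrable_rpow' (a := t - a) (b := t - b)
    (r := -α) (by linarith)).comp_sub_left t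
  simpa using h

theorem integral_sub_rpow_neg {α : ℝ} (hα1 : α < 1) (t a b : ℝ) :
    ∫ s in a..b, (t - s) ^ (-α) = ((t - a) ^ (1 - α) - (t - b) ^ (1 - α)) / (1 - α) := by
  rw [intervalIntegral.integral_comp_sub_left (fun x => x ^ (-α)) t,
    integral_rpow (Or.inl (by linarith)), neg_add_eq_sub]

theorem monotoneOn_sub_rpow_neg {α : ℝ} (hα0 : 0 < α) (t : ℝ) :
    MonotoneOn (fun s => (t - s) ^ (-α)) (Set.Iio t) := by
  intro x hx y hy hxy
  exact Real.rpow_le_rpow_of_nonpos (sub_pos.2 hy) (by linarith) (by linarith)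

/-- The kernel integrates over a grid cell to a multiple of an L1 coefficient. -/
theorem integral_cell_eq_bcoef {α δ : ℝ} (hα1 : α < 1) (hδ : 0 < δ) {i k : ℕ} (hi : i ≤ k) :
    ∫ s in ((i : ℝ) * δ)..(((i + 1 : ℕ) : ℝ) * δ), (((k : ℝ) + 1) * δ - s) ^ (-α)
      = δ ^ (1 - α) * bcoef α (k - i) / (1 - α) := by
  have hik : (i : ℝ) ≤ k := by exact_mod_cast hi
  rw [integral_sub_rpow_neg hα1, bcoef, Nat.cast_sub hi, mul_sub,
    ← Real.mul_rpow hδ.le (by linarith), ← Real.mul_rpow hδ.le (by linarith)]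
  push_cast
  ring_nf

/-- The weighted defect of the piecewise linear interpolant of `u`, summed over the grid. -/
theorem abs_sum_integral_defect_le {α δ M : ℝ} (hα0 : 0 < α) (hα1 : α < 1) (hδ : 0 < δ)
    {u : ℝ → ℝ} (hu : ContDiff ℝ 2 u) (k : ℕ)
    (hM : ∀ t ∈ Set.Icc (0 : ℝ) (((k : ℝ) + 1) * δ), |deriv (deriv u) t| ≤ M) :
    |∑ i ∈ Finset.range (k + 1), ∫ s in ((i : ℝ) * δ)..(((i + 1 : ℕ) : ℝ) * δ),
        (((k : ℝ) + 1) * δ - s) ^ (-α)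
          * (deriv u s - (u (((i + 1 : ℕ) : ℝ) * δ) - u ((i : ℝ) * δ)) / δ)|
      ≤ M * (1 + 1 / (1 - α)) * δ ^ (2 - α) := by
  set t : ℝ := ((k : ℝ) + 1) * δ with ht
  have ht0 : 0 < t := by positivity
  have hM0 : 0 ≤ M := (abs_nonneg _).trans (hM 0 ⟨le_rfl, ht0.le⟩)
  have hlen : ∀ i : ℕ, ((i + 1 : ℕ) : ℝ) * δ - (i : ℝ) * δ = δ := by
    intro i; push_cast; ring
  have hlt : ∀ i : ℕ, (i : ℝ) * δ < ((i + 1 : ℕ) : ℝ) * δ := fun i => by linarith [hlen i]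
  have hle : ∀ i ≤ k, ((i + 1 : ℕ) : ℝ) * δ ≤ t := by
    intro i hi
    have hik : (i : ℝ) ≤ k := by exact_mod_cast hi
    push_cast
    exact mul_le_mul_of_nonneg_right (by linarith) hδ.le
  have hdefect : ∀ i ≤ k, ∀ s ∈ Set.Icc ((i : ℝ) * δ) (((i + 1 : ℕ) : ℝ) * δ),
      |deriv u s - (u (((i + 1 : ℕ) : ℝ) * δ) - u ((i : ℝ) * δ)) / δ| ≤ M * δ := by
    intro i hi
    have h := abs_deriv_sub_slope_le (M := M) (hlt i) hu fun x hx =>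
      hM x ⟨le_trans (by positivity) hx.1, hx.2.trans (hle i hi)⟩
    rwa [hlen i] at h
  have hpow1 : δ * δ ^ (1 - α) = δ ^ (2 - α) := by
    rw [show (2 : ℝ) - α = 1 + (1 - α) by ring, Real.rpow_add hδ, Real.rpow_one]
  have hpow2 : δ * δ * δ ^ (-α) = δ ^ (2 - α) := by
    rw [← hpow1, show (1 : ℝ) - α = 1 + -α by ring, Real.rpow_add hδ, Real.rpow_one, mul_assoc]
  have hinner : ∀ i ∈ Finset.range k,
      |∫ s in ((i : ℝ) * δ)..(((i + 1 : ℕ) : ℝ) * δ), (t - s) ^ (-α)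
          * (deriv u s - (u (((i + 1 : ℕ) : ℝ) * δ) - u ((i : ℝ) * δ)) / δ)|
        ≤ M * δ * δ * ((t - ((i + 1 : ℕ) : ℝ) * δ) ^ (-α) - (t - (i : ℝ) * δ) ^ (-α)) := by
    intro i hi
    have hik : i < k := Finset.mem_range.1 hi
    have hmean := integral_deriv_sub_slope (hlt i) hu
    rw [hlen i] at hmean
    have hlast : ((i + 1 : ℕ) : ℝ) * δ < t := (hlt (i + 1)).trans_le (hle (i + 1) hik)
    have h := abs_integral_mul_le_of_integral_eq_zero (hlt i).le
      ((monotoneOn_sub_rpow_neg hα0 t).mono fun x hx => hx.2.trans_lt hlast)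
      ((hu.continuous_deriv (by norm_num)).sub continuous_const) hmean (hdefect i hik.le)
    rwa [hlen i] at h
  have hlastcell :
      |∫ s in ((k : ℝ) * δ)..(((k + 1 : ℕ) : ℝ) * δ), (t - s) ^ (-α)
          * (deriv u s - (u (((k + 1 : ℕ) : ℝ) * δ) - u ((k : ℝ) * δ)) / δ)|
        ≤ M * (1 / (1 - α)) * δ ^ (2 - α) := by
    have h := intervalIntegral.norm_integral_le_of_norm_le (μ := volume) (hlt k).le
      (f := fun s => (t - s) ^ (-α)
          * (deriv u s - (u (((k + 1 : ℕ) : ℝ) * δ) - u ((k : ℝ) * δ)) / δ))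
      (g := fun s => (t - s) ^ (-α) * (M * δ))
      (Filter.Eventually.of_forall fun s hs => by
        have hnn : 0 ≤ (t - s) ^ (-α) :=
          Real.rpow_nonneg (sub_nonneg.2 (hs.2.trans (hle k le_rfl))) _
        rw [Real.norm_eq_abs, abs_mul, abs_of_nonneg hnn]
        exact mul_le_mul_of_nonneg_left (hdefect k le_rfl s ⟨hs.1.le, hs.2⟩) hnn)
      ((intervalIntegrable_sub_rpow_neg hα1 t _ _).mul_const _)
    rw [intervalIntegral.integral_mul_const, ht, integral_cell_eq_bcoef hα1 hδ le_rfl] at h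
    have hb : bcoef α (k - k) = 1 := by
      simp [bcoef, Real.zero_rpow (sub_pos.2 hα1).ne']
    rw [hb, ← ht, Real.norm_eq_abs] at h
    refine h.trans (le_of_eq ?_)
    rw [← hpow1]
    ring
  have htel : ∑ i ∈ Finset.range k,
      ((t - ((i + 1 : ℕ) : ℝ) * δ) ^ (-α) - (t - (i : ℝ) * δ) ^ (-α)) ≤ δ ^ (-α) := by
    rw [Finset.sum_range_sub (fun i : ℕ => (t - (i : ℝ) * δ) ^ (-α))]
    have h1 : t - (k : ℝ) * δ = δ := by rw [ht]; ring
    rw [h1]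
    have h2 : 0 ≤ (t - ((0 : ℕ) : ℝ) * δ) ^ (-α) := Real.rpow_nonneg (by simpa using ht0.le) _
    linarith
  rw [Finset.sum_range_succ]
  calc _ ≤ _ := abs_add_le _ _
    _ ≤ M * δ * δ * δ ^ (-α) + M * (1 / (1 - α)) * δ ^ (2 - α) := by
      refine add_le_add ?_ hlastcell
      refine (Finset.abs_sum_le_sum_abs _ _).trans ((Finset.sum_le_sum hinner).trans ?_)
      rw [← Finset.mul_sum]
      exact mul_le_mul_of_nonneg_left htel (by positivity)
    _ = M * (1 + 1 / (1 - α)) * δ ^ (2 - α) := by rw [← hpow2]; ring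

/-- The L1 truncation error is the weighted defect of the piecewise linear interpolant. -/
theorem caputo_sub_L1_eq_sum_integral_defect {α δ : ℝ} (hα1 : α < 1) (hδ : 0 < δ)
    {u : ℝ → ℝ} (hu : ContDiff ℝ 2 u) (k : ℕ) :
    (1 / Real.Gamma (1 - α))
        * (∫ s in (0 : ℝ)..(((k : ℝ) + 1) * δ), (((k : ℝ) + 1) * δ - s) ^ (-α) * deriv u s)
      - (1 / Real.Gamma (2 - α)) * δ ^ (-α)
          * ∑ j ∈ Finset.range (k + 1),
              bcoef α j * (u (((k + 1 - j : ℕ) : ℝ) * δ) - u (((k - j : ℕ) : ℝ) * δ))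
      = (1 / Real.Gamma (1 - α)) *
        ∑ i ∈ Finset.range (k + 1), ∫ s in ((i : ℝ) * δ)..(((i + 1 : ℕ) : ℝ) * δ),
          (((k : ℝ) + 1) * δ - s) ^ (-α)
            * (deriv u s - (u (((i + 1 : ℕ) : ℝ) * δ) - u ((i : ℝ) * δ)) / δ) := by
  have hα : 0 < 1 - α := sub_pos.2 hα1
  have hΓ : Real.Gamma (1 - α) ≠ 0 := (Real.Gamma_pos_of_pos hα).ne'
  have hΓ2 : Real.Gamma (2 - α) = (1 - α) * Real.Gamma (1 - α) := by
    rw [← Real.Gamma_add_one hα.ne']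
    ring_nf
  have hc : Continuous (deriv u) := hu.continuous_deriv (by norm_num)
  have hw := intervalIntegrable_sub_rpow_neg hα1 (((k : ℝ) + 1) * δ)
  have hint := intervalIntegral.sum_integral_adjacent_intervals (μ := volume)
    (f := fun s => (((k : ℝ) + 1) * δ - s) ^ (-α) * deriv u s)
    (a := fun i : ℕ => (i : ℝ) * δ) (n := k + 1)
    (fun i _ => (hw _ _).mul_continuousOn hc.continuousOn)
  have hreflect : ∑ j ∈ Finset.range (k + 1),
        bcoef α j * (u (((k + 1 - j : ℕ) : ℝ) * δ) - u (((k - j : ℕ) : ℝ) * δ))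
      = ∑ i ∈ Finset.range (k + 1),
        bcoef α (k - i) * (u (((i + 1 : ℕ) : ℝ) * δ) - u ((i : ℝ) * δ)) := by
    rw [← Finset.sum_range_reflect]
    refine Finset.sum_congr rfl fun i hi => ?_
    have hi' : i < k + 1 := Finset.mem_range.1 hi
    rw [show k + 1 - 1 - i = k - i by omega, show k + 1 - (k - i) = i + 1 by omega,
      show k - (k - i) = i by omega]
  have hcell : ∀ i ∈ Finset.range (k + 1),
      ∫ s in ((i : ℝ) * δ)..(((i + 1 : ℕ) : ℝ) * δ), (((k : ℝ) + 1) * δ - s) ^ (-α)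
          * (deriv u s - (u (((i + 1 : ℕ) : ℝ) * δ) - u ((i : ℝ) * δ)) / δ)
        = (∫ s in ((i : ℝ) * δ)..(((i + 1 : ℕ) : ℝ) * δ),
            (((k : ℝ) + 1) * δ - s) ^ (-α) * deriv u s)
          - δ ^ (-α) / (1 - α)
            * (bcoef α (k - i) * (u (((i + 1 : ℕ) : ℝ) * δ) - u ((i : ℝ) * δ))) := by
    intro i hi
    simp only [mul_sub ((_ : ℝ) ^ (-α)) (deriv u _)]
    rw [intervalIntegral.integral_sub ((hw _ _).mul_continuousOn hc.continuousOn)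
      ((hw _ _).mul_const _), intervalIntegral.integral_mul_const,
      integral_cell_eq_bcoef hα1 hδ (Nat.lt_succ_iff.1 (Finset.mem_range.1 hi)),
      show (1 : ℝ) - α = 1 + -α by ring, Real.rpow_add hδ, Real.rpow_one]
    field_simp
  rw [Finset.sum_congr rfl hcell, Finset.sum_sub_distrib, hint, ← Finset.mul_sum, hreflect, hΓ2]
  push_cast
  rw [zero_mul]
  field_simp

/-- L1 truncation error bound: the constant `C` depends only on `α` and on a bound `M`
for `sup_{t ∈ [0,T]} |u''(t)|`. -/
theorem caputo_L1_truncation_error (α : ℝ) (hα0 : 0 < α) (hα1 : α < 1) (M : ℝ) :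
    ∃ C : ℝ, 0 ≤ C ∧
      ∀ (T : ℝ) (K : ℕ) (δ : ℝ) (u : ℝ → ℝ),
        0 < T → 0 < K → δ = T / K →
        ContDiff ℝ 2 u →
        (∀ t ∈ Set.Icc (0 : ℝ) T, |deriv (deriv u) t| ≤ M) →
        ∀ k : ℕ, k ≤ K - 1 →
          |(1 / Real.Gamma (1 - α))
              * (∫ s in (0 : ℝ)..(((k : ℝ) + 1) * δ),
                  (((k : ℝ) + 1) * δ - s) ^ (-α) * deriv u s)
            - (1 / Real.Gamma (2 - α)) * δ ^ (-α)
                * ∑ j ∈ Finset.range (k + 1),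
                    bcoef α j * (u (((k + 1 - j : ℕ) : ℝ) * δ) - u (((k - j : ℕ) : ℝ) * δ))|
            ≤ C * δ ^ (2 - α) := by
  have hα : 0 < 1 - α := sub_pos.2 hα1
  have hΓ : 0 < Real.Gamma (1 - α) := Real.Gamma_pos_of_pos hα
  refine ⟨1 / Real.Gamma (1 - α) * (|M| * (1 + 1 / (1 - α))), by positivity, ?_⟩
  intro T K δ u hT hK hδ hu hM k hk
  have hK' : (0 : ℝ) < K := by exact_mod_cast hK
  have hδ0 : 0 < δ := hδ ▸ div_pos hT hK'
  have hkK : (k : ℝ) + 1 ≤ K := by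
    have : k + 1 ≤ K := by omega
    exact_mod_cast this
  have htT : ((k : ℝ) + 1) * δ ≤ T :=
    (mul_le_mul_of_nonneg_right hkK hδ0.le).trans_eq (by rw [hδ]; field_simp)
  rw [caputo_sub_L1_eq_sum_integral_defect hα1 hδ0 hu, abs_mul,
    abs_of_pos (one_div_pos.2 hΓ), mul_assoc]
  refine mul_le_mul_of_nonneg_left ?_ (one_div_pos.2 hΓ).le
  exact abs_sum_integral_defect_le hα0 hα1 hδ0 hu k fun t ht =>
    (hM t ⟨ht.1, ht.2.trans htT⟩).trans (le_abs_self M)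
end

section
/- Let 0 < α < 1 and b_j := (j+1)^{1-α} − j^{1-α} for integers j ≥ 0. Let (E_k)_{k≥0} and (G_k)_{k≥0} be sequences of nonnegative real numbers satisfying: E_0 ≤ G_0; E_1 ≤ E_0 + G_1; and for every integer k ≥ 1, E_{k+1} ≤ (1 − b_1) E_k + ∑_{j=1}^{k-1} (b_j − b_{j+1}) E_{k-j} + b_k E_0 + G_{k+1}. Then for every integer k ≥ 1, E_k ≤ 2 · b_{k-1}^{−1} · max_{0 ≤ j ≤ k} G_j. -/
theorem bcoef_zero {α : ℝ} (hα1 : α < 1) : bcoef α 0 = 1 := by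
  have h : (1 : ℝ) - α ≠ 0 := by linarith
  simp [bcoef, Real.zero_rpow h]

theorem bcoef_pos {α : ℝ} (hα1 : α < 1) (j : ℕ) : 0 < bcoef α j :=
  sub_pos.mpr <| Real.rpow_lt_rpow j.cast_nonneg (lt_add_one _) (by linarith)

theorem bcoef_antitone {α : ℝ} (hα0 : 0 ≤ α) (hα1 : α ≤ 1) : Antitone (bcoef α) := by
  refine antitone_nat_of_succ_le fun j => ?_
  have hj : (0 : ℝ) ≤ j := j.cast_nonneg
  have hc := (Real.concaveOn_rpow (p := 1 - α) (by linarith) (by linarith)).2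
    (Set.mem_Ici.mpr hj) (Set.mem_Ici.mpr (by linarith : (0 : ℝ) ≤ (j : ℝ) + 1 + 1))
    (by norm_num : (0 : ℝ) ≤ 1 / 2) (by norm_num : (0 : ℝ) ≤ 1 / 2) (by norm_num)
  simp only [smul_eq_mul] at hc
  rw [show 1 / 2 * (j : ℝ) + 1 / 2 * ((j : ℝ) + 1 + 1) = (j : ℝ) + 1 by ring] at hc
  simp only [bcoef]
  push_cast
  linarith

/-- The discrete Grönwall bound for an arbitrary positive antitone kernel `b` with `b 0 = 1`. -/
theorem le_two_mul_inv_mul_of_antitone_kernel {b E G : ℕ → ℝ} (hb0 : b 0 = 1)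
    (hbpos : ∀ j, 0 < b j) (hb : Antitone b) (hG : ∀ k, 0 ≤ G k)
    (h0 : E 0 ≤ G 0) (h1 : E 1 ≤ E 0 + G 1)
    (hrec : ∀ k : ℕ, 1 ≤ k →
      E (k + 1) ≤ (1 - b 1) * E k + (∑ j ∈ Finset.Ico 1 k, (b j - b (j + 1)) * E (k - j))
        + b k * E 0 + G (k + 1))
    (k : ℕ) {M : ℝ} (hM : ∀ j ≤ k + 1, G j ≤ M) : E (k + 1) ≤ 2 * (b k)⁻¹ * M := by
  have hM0 : 0 ≤ M := (hG 0).trans (hM 0 (Nat.zero_le _))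
  have hE0 : E 0 ≤ M := h0.trans (hM 0 (Nat.zero_le _))
  induction k using Nat.strong_induction_on with
  | _ k ih =>
    rcases Nat.eq_zero_or_pos k with rfl | hk
    · have := hM 1 le_rfl
      simp only [hb0, zero_add]
      linarith
    have hprev : ∀ i, 1 ≤ i → i ≤ k → E i ≤ 2 * (b k)⁻¹ * M := by
      rintro (_ | i) hi hik
      · omega
      · calc E (i + 1) ≤ 2 * (b i)⁻¹ * M := ih i hik fun j hj => hM j (by omega)
          _ ≤ 2 * (b k)⁻¹ * M := by
            have := inv_anti₀ (hbpos k) (hb (by omega : i ≤ k))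
            gcongr
    have hsum : ∑ j ∈ Finset.Ico 1 k, (b j - b (j + 1)) * E (k - j)
        ≤ (b 1 - b k) * (2 * (b k)⁻¹ * M) := by
      have htel : b 1 - b k = ∑ j ∈ Finset.Ico 1 k, (b j - b (j + 1)) := by
        rw [← neg_sub (b k), ← Finset.sum_Ico_sub b hk, ← Finset.sum_neg_distrib]
        simp only [neg_sub]
      rw [htel, Finset.sum_mul]
      refine Finset.sum_le_sum fun j hj => ?_
      rw [Finset.mem_Ico] at hj
      exact mul_le_mul_of_nonneg_left (hprev _ (by omega) (by omega))
        (sub_nonneg.mpr (hb j.le_succ))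
    have hb1 : b 1 ≤ 1 := hb0 ▸ hb zero_le_one
    have hbk : b k ≤ 1 := hb0 ▸ hb k.zero_le
    have hfirst := mul_le_mul_of_nonneg_left (hprev k hk le_rfl) (sub_nonneg.mpr hb1)
    have hinit := mul_le_mul_of_nonneg_left hE0 (hbpos k).le
    have hinitM := mul_le_mul_of_nonneg_right hbk hM0
    have hcancel : b k * (2 * (b k)⁻¹ * M) = 2 * M := by
      have := (hbpos k).ne'
      field_simp
    have := hrec k hk
    have := hM (k + 1) le_rfl
    linarith


theorem discrete_fractional_gronwall (α : ℝ) (hα0 : 0 < α) (hα1 : α < 1)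
    (E G : ℕ → ℝ) (hE : ∀ k, 0 ≤ E k) (hG : ∀ k, 0 ≤ G k)
    (h0 : E 0 ≤ G 0) (h1 : E 1 ≤ E 0 + G 1)
    (hrec : ∀ k : ℕ, 1 ≤ k →
      E (k + 1) ≤ (1 - bcoef α 1) * E k
        + (∑ j ∈ Finset.Ico 1 k, (bcoef α j - bcoef α (j + 1)) * E (k - j))
        + bcoef α k * E 0 + G (k + 1)) :
    ∀ k : ℕ, 1 ≤ k →
      E k ≤ 2 * (bcoef α (k - 1))⁻¹
              * (Finset.range (k + 1)).sup' (Finset.nonempty_range_iff.mpr k.succ_ne_zero) G := by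
  rintro (_ | k) hk
  · omega
  · exact le_two_mul_inv_mul_of_antitone_kernel (bcoef_zero hα1) (bcoef_pos hα1)
      (bcoef_antitone hα0.le hα1.le) hG h0 h1 hrec k
      fun j hj => Finset.le_sup' G (Finset.mem_range.mpr (Nat.lt_succ_of_le hj))
end

section
/- Let 0 < α < 1 and b_j := (j+1)^{1-α} − j^{1-α} for integers j ≥ 0. Let D ≥ 0 and let (E_k)_{k≥0} be a sequence of nonnegative real numbers satisfying: E_0 = 0; E_1 ≤ D; and for every integer k ≥ 1, E_{k+1} ≤ (1 − b_1) E_k + ∑_{j=1}^{k-1} (b_j − b_{j+1}) E_{k-j} + b_k E_0 + D. Then for every integer k ≥ 0, E_k ≤ k·D. -/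
theorem bcoef_nonneg {α : ℝ} (hα1 : α ≤ 1) (j : ℕ) : 0 ≤ bcoef α j :=
  sub_nonneg.2 (Real.rpow_le_rpow j.cast_nonneg (by linarith) (by linarith))

theorem discrete_gronwall_linear_growth (α : ℝ) (hα0 : 0 < α) (hα1 : α < 1)
    (D : ℝ) (hD : 0 ≤ D)
    (E : ℕ → ℝ) (hE : ∀ k, 0 ≤ E k)
    (h0 : E 0 = 0) (h1 : E 1 ≤ D)
    (hrec : ∀ k : ℕ, 1 ≤ k →
      E (k + 1) ≤ (1 - bcoef α 1) * E k
        + (∑ j ∈ Finset.Ico 1 k, (bcoef α j - bcoef α (j + 1)) * E (k - j))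
        + bcoef α k * E 0 + D) :
    ∀ k : ℕ, E k ≤ (k : ℝ) * D := by
  have hb := bcoef_antitone hα0.le hα1.le
  intro k
  induction k using Nat.strong_induction_on with
  | _ n ih =>
    match n, ih with
    | 0, _ => simp [h0]
    | 1, _ => simpa using h1
    | m + 2, ih =>
      set k := m + 1 with hk
      have hprev : ∀ i ≤ k, E i ≤ k * D := fun i hi =>
        (ih i (by omega)).trans (by gcongr)
      have hb1 : bcoef α 1 ≤ 1 := bcoef_zero hα1 ▸ hb zero_le_one
      have hfirst : (1 - bcoef α 1) * E k ≤ (1 - bcoef α 1) * (k * D) :=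
        mul_le_mul_of_nonneg_left (hprev k le_rfl) (sub_nonneg.2 hb1)
      have hsum : ∑ j ∈ Finset.Ico 1 k, (bcoef α j - bcoef α (j + 1)) * E (k - j)
          ≤ (bcoef α 1 - bcoef α k) * (k * D) := by
        have htel : ∑ j ∈ Finset.Ico 1 k, (bcoef α j - bcoef α (j + 1))
            = bcoef α 1 - bcoef α k := by
          have h := Finset.sum_Ico_sub (bcoef α) (show 1 ≤ k by omega)
          rw [← neg_sub (bcoef α k), ← h, ← Finset.sum_neg_distrib]
          simp only [neg_sub]
        rw [← htel, Finset.sum_mul]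
        exact Finset.sum_le_sum fun j _ => mul_le_mul_of_nonneg_left
          (hprev _ (Nat.sub_le k j)) (sub_nonneg.2 (hb j.le_succ))
      have hlast : 0 ≤ bcoef α k * (k * D) :=
        mul_nonneg (bcoef_nonneg hα1.le k) (by positivity)
      have h := hrec k (by omega)
      rw [h0] at h
      have hcast : ((m + 2 : ℕ) : ℝ) * D = k * D + D := by
        rw [hk]; push_cast; ring
      rw [hcast]
      change E (k + 1) ≤ _
      linarith
end
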